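/- arXiv:1711.07881 — 3 statements merged into one kernel-verified Lean document; each statement's English description precedes it below -/
import Mathlib

section
/- For every α ∈ Φ_O and every β ∈ Φ, if neither α + β nor α − β lies in Φ ∪ {0}, then (α,β) = 0. -/
noncomputable section

open Finset

attribute [local instance] Classical.propDecidable

/-- Standard inner product on ℝ^N. -/
def inn {N : ℕ} (x y : Fin N → ℝ) : ℝ := ∑ i, x i * y i

/-- Standard basis vector k_i (0-indexed). -/
def kvec {N : ℕ} (i : Fin N) : Fin N → ℝ := fun j => if j = i then 1 else 0

/-- Φ_O : the roots ±k_i ± k_j, i < j (all four sign choices). -/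
def PhiO {N : ℕ} : Set (Fin N → ℝ) :=
  {x | ∃ i j : Fin N, i < j ∧ ∃ s t : ℝ, (s = 1 ∨ s = -1) ∧ (t = 1 ∨ t = -1) ∧
    x = s • kvec i + t • kvec j}

/-- Φ_S : the roots (1/2)(ε_1 k_1 + ⋯ + ε_N k_N), each ε_i = ±1, an even number of ε_i = +1. -/
def PhiS {N : ℕ} : Set (Fin N → ℝ) :=
  {x | ∃ ε : Fin N → ℝ, (∀ i, ε i = 1 ∨ ε i = -1) ∧
    Even ((Finset.univ.filter fun i => ε i = 1).card) ∧
    x = fun i => ε i / 2}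

/-- The set of extended roots of e8^(n) (with N = 4(n+1)). -/
def Phi {N : ℕ} : Set (Fin N → ℝ) := PhiO ∪ PhiS

lemma inn_smul_kvec_add {N : ℕ} (i j : Fin N) (s t : ℝ) (x : Fin N → ℝ) :
    inn (s • kvec i + t • kvec j) x = s * x i + t * x j := by
  simp [inn, kvec, add_mul, Finset.sum_add_distrib]

lemma smul_kvec_add_mem_PhiO {N : ℕ} {i j : Fin N} (hij : i ≠ j) {s t : ℝ}
    (hs : s = 1 ∨ s = -1) (ht : t = 1 ∨ t = -1) :
    s • kvec i + t • kvec j ∈ (PhiO : Set (Fin N → ℝ)) := by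
  rcases lt_or_gt_of_ne hij with h | h
  · exact ⟨i, j, h, s, t, hs, ht, rfl⟩
  · exact ⟨j, i, h, t, s, ht, hs, add_comm _ _⟩

/-- Two roots of `PhiO` with a common index are orthogonal, or their sum or difference is
a root or zero. -/
lemma inn_eq_zero_or_mem_of_common_index {N : ℕ} {i j b : Fin N} (hij : i ≠ j) (hib : i ≠ b)
    {s t u v : ℝ} (hs : s = 1 ∨ s = -1) (ht : t = 1 ∨ t = -1)
    (hu : u = 1 ∨ u = -1) (hv : v = 1 ∨ v = -1) {α β : Fin N → ℝ}
    (hα : α = s • kvec i + t • kvec j) (hβ : β = u • kvec i + v • kvec b) :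
    inn α β = 0 ∨ α + β ∈ (Phi : Set (Fin N → ℝ)) ∪ {0} ∨
      α - β ∈ (Phi : Set (Fin N → ℝ)) ∪ {0} := by
  by_cases hjb : j = b
  · subst hjb hα hβ
    rw [inn_smul_kvec_add]
    have hi : (u • kvec i + v • kvec j : Fin N → ℝ) i = u := by simp [kvec, hij]
    have hj : (u • kvec i + v • kvec j : Fin N → ℝ) j = v := by simp [kvec, hij.symm]
    rw [hi, hj]
    rcases hs with rfl | rfl <;> rcases ht with rfl | rfl <;> rcases hu with rfl | rfl <;>
      rcases hv with rfl | rfl <;>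
      first
        | (left; norm_num; done)
        | (right; left; right; simp only [Set.mem_singleton_iff]; module)
        | (right; right; right; simp only [Set.mem_singleton_iff]; module)
  · right
    have hv' : -v = 1 ∨ -v = -1 := by grind
    by_cases hsu : s = u
    · right; left; left
      have h : α - β = t • kvec j + (-v) • kvec b := by rw [hα, hβ, hsu]; module
      rw [h]
      exact smul_kvec_add_mem_PhiO hjb ht hv'
    · left; left; left
      have hsu' : s = -u := by grind
      have h : α + β = t • kvec j + v • kvec b := by rw [hα, hβ, hsu']; module
      rw [h]
      exact smul_kvec_add_mem_PhiO hjb ht hv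

lemma even_card_filter_eq_one_iff {N : ℕ} {ε : Fin N → ℝ} (hε : ∀ i, ε i = 1 ∨ ε i = -1) :
    Even ((Finset.univ.filter fun i => ε i = 1).card) ↔ ∏ i, -ε i = 1 := by
  have h : ∏ i, -ε i = (-1) ^ (Finset.univ.filter fun i => ε i = 1).card := by
    rw [← Finset.prod_const, Finset.prod_filter]
    refine Finset.prod_congr rfl fun i _ => ?_
    rcases hε i with h | h <;> rw [h] <;> norm_num
  rw [h, neg_one_pow_eq_one_iff_even (by norm_num)]

lemma neg_mem_PhiS {N : ℕ} (hN : Even N) {x : Fin N → ℝ} (hx : x ∈ (PhiS : Set (Fin N → ℝ))) :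
    -x ∈ (PhiS : Set (Fin N → ℝ)) := by
  obtain ⟨ε, hε, hev, rfl⟩ := hx
  have hε' : ∀ i, -ε i = 1 ∨ -ε i = -1 := fun i => by rcases hε i with h | h <;> simp [h]
  refine ⟨fun i => -ε i, hε', ?_, by ext i; simp [neg_div]⟩
  rw [even_card_filter_eq_one_iff hε] at hev
  rw [even_card_filter_eq_one_iff hε', Finset.prod_neg, hev]
  simp [hN.neg_one_pow]

/-- Reversing two signs of a root of `PhiS` gives a root of `PhiS`. -/
lemma sub_smul_kvec_add_mem_PhiS {N : ℕ} {i j : Fin N} (hij : i ≠ j) {x : Fin N → ℝ}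
    (hx : x ∈ (PhiS : Set (Fin N → ℝ))) :
    x - ((2 * x i) • kvec i + (2 * x j) • kvec j) ∈ (PhiS : Set (Fin N → ℝ)) := by
  obtain ⟨ε, hε, hev, rfl⟩ := hx
  let δ : Fin N → ℝ := fun k => ε k * ((if k = i then -1 else 1) * (if k = j then -1 else 1))
  have hδ : ∀ k, δ k = 1 ∨ δ k = -1 := fun k => by
    rcases hε k with h | h <;> simp only [δ, h] <;> split_ifs <;> norm_num
  refine ⟨δ, hδ, ?_, ?_⟩
  · rw [even_card_filter_eq_one_iff hε] at hev
    rw [even_card_filter_eq_one_iff hδ]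
    simp only [δ, ← neg_mul]
    rw [Finset.prod_mul_distrib, hev, Finset.prod_mul_distrib]
    simp
  · ext k
    by_cases hi : k = i
    · subst hi
      simp [δ, kvec, hij]; ring
    · by_cases hj : k = j
      · subst hj
        simp [δ, kvec, hi]; ring
      · simp [δ, kvec, hi, hj]

/-- For α ∈ Φ_O and β ∈ Φ, if neither α + β nor α - β lies in Φ ∪ {0},
then (α,β) = 0. -/
theorem stmt8 (n : ℕ) (hn : 1 ≤ n) (α β : Fin (4*(n+1)) → ℝ)
    (hα : α ∈ (PhiO : Set (Fin (4*(n+1)) → ℝ)))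
    (hβ : β ∈ (Phi : Set (Fin (4*(n+1)) → ℝ)))
    (hs : α + β ∉ (Phi : Set (Fin (4*(n+1)) → ℝ)) ∪ {0})
    (hd : α - β ∉ (Phi : Set (Fin (4*(n+1)) → ℝ)) ∪ {0}) :
    inn α β = 0 := by
  obtain ⟨i, j, hij, s, t, h1, h2, hα⟩ := hα
  have hα' : α = t • kvec j + s • kvec i := hα.trans (add_comm _ _)
  rcases hβ with hβ | hβ
  · obtain ⟨a, b, hab, u, v, h3, h4, hβ⟩ := hβ
    have hβ' : β = v • kvec b + u • kvec a := hβ.trans (add_comm _ _)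
    by_cases hia : i = a
    · subst hia
      have := inn_eq_zero_or_mem_of_common_index hij.ne hab.ne h1 h2 h3 h4 hα hβ
      tauto
    by_cases hib : i = b
    · subst hib
      have := inn_eq_zero_or_mem_of_common_index hij.ne hab.ne' h1 h2 h4 h3 hα hβ'
      tauto
    by_cases hja : j = a
    · subst hja
      have := inn_eq_zero_or_mem_of_common_index hij.ne' hab.ne h2 h1 h3 h4 hα' hβ
      tauto
    by_cases hjb : j = b
    · subst hjb
      have := inn_eq_zero_or_mem_of_common_index hij.ne' hab.ne' h2 h1 h4 h3 hα' hβ'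
      tauto
    rw [hα, inn_smul_kvec_add, hβ]
    simp [kvec, hia, hib, hja, hjb]
  · have hmem := sub_smul_kvec_add_mem_PhiS hij.ne hβ
    have hhalf : ∀ k, 2 * β k = 1 ∨ 2 * β k = -1 := fun k => by
      obtain ⟨ε, hε, -, rfl⟩ := hβ
      have := hε k
      grind
    have hi := hhalf i
    have hj := hhalf j
    by_contra hne
    rw [hα, inn_smul_kvec_add] at hne
    have hcase : (s = 2 * β i ∧ t = 2 * β j) ∨ (s = -(2 * β i) ∧ t = -(2 * β j)) := by
      grind
    rcases hcase with ⟨hsi, htj⟩ | ⟨hsi, htj⟩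
    · refine hd (Or.inl (Or.inr ?_))
      have hN : Even (4 * (n + 1)) := ⟨2 * (n + 1), by ring⟩
      rw [← neg_sub, hα, hsi, htj]
      exact neg_mem_PhiS hN hmem
    · refine hs (Or.inl (Or.inr ?_))
      have h : α + β = β - ((2 * β i) • kvec i + (2 * β j) • kvec j) := by
        rw [hα, hsi, htj]; module
      rw [h]
      exact hmem
end
end

section
/- For all α = ∑_{i=1}^N m_i α_i and β = ∑_{i=1}^N n_i α_i in the lattice L, the inner product (α,β) is an integer and the asymmetry function satisfies ε(α,β)ε(β,α) = (−1)^{(α,β) − m_N n_N (n−1)}. -/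
noncomputable section

open Finset

attribute [local instance] Classical.propDecidable

/-- The simple extended roots α_1, …, α_N (0-indexed): for i ≤ N-3 (i.e. α_1,…,α_{N-2}
1-indexed) it is k_i - k_{i+1}; for i = N-2 (i.e. α_{N-1}) it is k_{N-2} + k_{N-1}
(1-indexed); for i = N-1 (i.e. α_N) it is -(1/2)(k_1 + ⋯ + k_N). -/
def alphaRoot {N : ℕ} (i : Fin N) : Fin N → ℝ :=
  fun j =>
    if (i : ℕ) = N - 1 then -(1/2)
    else if (i : ℕ) = N - 2 then (if (j : ℕ) = N - 3 ∨ (j : ℕ) = N - 2 then 1 else 0)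
    else (if (j : ℕ) = (i : ℕ) then 1 else if (j : ℕ) = (i : ℕ) + 1 then -1 else 0)

/-- The lattice element with integer coordinates `c` w.r.t. the simple extended roots. -/
def toVec {N : ℕ} (c : Fin N → ℤ) : Fin N → ℝ := ∑ i, (c i : ℝ) • alphaRoot i

/-- The asymmetry function on pairs of simple extended roots: ε(α_i,α_i) = -1,
ε(α_i,α_j) = -1 if α_i + α_j is an extended root and α_i < α_j (i.e. i > j in the
ordering α_i > α_{i+1}), and +1 otherwise. -/
def epsSign {N : ℕ} (i j : Fin N) : ℤˣ :=
  if i = j then -1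
  else if (alphaRoot i + alphaRoot j) ∈ (Phi : Set (Fin N → ℝ)) ∧ j < i then -1
  else 1

/-- The asymmetry function ε : L × L → {-1,1}, written on integer coordinate vectors
w.r.t. the basis of simple extended roots:
ε(α,β) = ∏_{i,j} ε(α_i,α_j)^{ℓ_i m_j} for α = ∑ ℓ_i α_i, β = ∑ m_j α_j. -/
def epsFun {N : ℕ} (l m : Fin N → ℤ) : ℤˣ :=
  ∏ i, ∏ j, (epsSign i j) ^ (l i * m j)

lemma inn_comm {N : ℕ} (x y : Fin N → ℝ) : inn x y = inn y x := by
  simp only [inn, mul_comm]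

lemma inn_add_left {N : ℕ} (x y z : Fin N → ℝ) : inn (x + y) z = inn x z + inn y z := by
  simp only [inn, Pi.add_apply, add_mul, sum_add_distrib]

lemma inn_sub_left {N : ℕ} (x y z : Fin N → ℝ) : inn (x - y) z = inn x z - inn y z := by
  simp only [inn, Pi.sub_apply, sub_mul, sum_sub_distrib]

lemma inn_smul_left {N : ℕ} (s : ℝ) (x z : Fin N → ℝ) : inn (s • x) z = s * inn x z := by
  simp only [inn, Pi.smul_apply, smul_eq_mul, mul_sum, mul_assoc]

lemma inn_kvec_left {N : ℕ} (i : Fin N) (x : Fin N → ℝ) : inn (kvec i) x = x i := by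
  simp [inn, kvec]

lemma inn_toVec {N : ℕ} (a b : Fin N → ℤ) :
    inn (toVec a) (toVec b) =
      ∑ i, ∑ j, (a i : ℝ) * b j * inn (alphaRoot i : Fin N → ℝ) (alphaRoot j) := by
  have key : ∀ (c : Fin N → ℤ) (z : Fin N → ℝ),
      inn (toVec c) z = ∑ i, (c i : ℝ) * inn (alphaRoot i) z := by
    intro c z
    simp only [inn, toVec, Finset.sum_apply, Pi.smul_apply, smul_eq_mul, sum_mul, mul_sum]
    rw [sum_comm]
    simp only [mul_assoc]
  rw [key]
  refine sum_congr rfl fun i _ => ?_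
  rw [inn_comm, key, mul_sum]
  refine sum_congr rfl fun j _ => ?_
  rw [inn_comm, mul_assoc]

/-- Adjacency of vertices `i < j` in the Dynkin diagram of the simple extended roots. -/
def DynkinAdj (N i j : ℕ) : Prop :=
  (j = i + 1 ∧ j + 3 ≤ N) ∨ (i + 4 = N ∧ j + 2 = N) ∨ (i + 2 = N ∧ j + 1 = N)

lemma alphaRoot_eq_sub {N : ℕ} (i : Fin N) (h : (i : ℕ) + 3 ≤ N) :
    (alphaRoot i : Fin N → ℝ) = kvec i - kvec ⟨i + 1, by omega⟩ := by
  funext j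
  simp only [alphaRoot, kvec, Pi.sub_apply, Fin.ext_iff]
  split_ifs <;> first | omega | norm_num

lemma alphaRoot_eq_add {N : ℕ} (hN : 3 ≤ N) (i : Fin N) (h : (i : ℕ) + 2 = N) :
    (alphaRoot i : Fin N → ℝ) = kvec ⟨N - 3, by omega⟩ + kvec ⟨N - 2, by omega⟩ := by
  funext j
  simp only [alphaRoot, kvec, Pi.add_apply, Fin.ext_iff]
  split_ifs <;> first | omega | norm_num

lemma alphaRoot_last {N : ℕ} (i : Fin N) (h : (i : ℕ) + 1 = N) :
    (alphaRoot i : Fin N → ℝ) = fun _ => -(1 / 2) := by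
  funext j
  simp only [alphaRoot]
  rw [if_pos (by omega)]

lemma inn_alphaRoot_of_lt {N : ℕ} (hN : 4 ≤ N) (i j : Fin N) (hij : i < j) :
    inn (alphaRoot i : Fin N → ℝ) (alphaRoot j) = if DynkinAdj N i j then -1 else 0 := by
  have hij' : (i : ℕ) < j := hij
  have hj := j.2
  by_cases h : (i : ℕ) + 3 ≤ N
  · rw [alphaRoot_eq_sub i h, inn_sub_left, inn_kvec_left, inn_kvec_left]
    by_cases hadj : DynkinAdj N i j
    · rw [if_pos hadj]
      unfold DynkinAdj at hadj
      simp only [alphaRoot]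
      split_ifs <;> first | omega | norm_num
    · rw [if_neg hadj]
      unfold DynkinAdj at hadj
      simp only [alphaRoot]
      split_ifs <;> first | omega | norm_num
  · rw [alphaRoot_eq_add (by omega) i (by omega), inn_add_left, inn_kvec_left, inn_kvec_left,
      alphaRoot_last j (by omega), if_pos (by unfold DynkinAdj; omega)]
    norm_num

lemma inn_alphaRoot_self {N : ℕ} (hN : 4 ≤ N) (i : Fin N) :
    inn (alphaRoot i : Fin N → ℝ) (alphaRoot i) = if (i : ℕ) + 1 = N then (N : ℝ) / 4 else 2 := by
  have hi := i.2
  split_ifs with h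
  · simp only [alphaRoot_last i h, inn, sum_const, card_univ, Fintype.card_fin, nsmul_eq_mul]
    ring
  · by_cases h : (i : ℕ) + 3 ≤ N
    · rw [alphaRoot_eq_sub i h, inn_sub_left, inn_kvec_left, inn_kvec_left]
      simp only [kvec, Pi.sub_apply, Fin.ext_iff]
      split_ifs <;> first | omega | norm_num
    · rw [alphaRoot_eq_add (by omega) i (by omega), inn_add_left, inn_kvec_left, inn_kvec_left]
      simp only [kvec, Pi.add_apply, Fin.ext_iff]
      split_ifs <;> first | omega | norm_num

lemma inn_self_of_mem_PhiO {N : ℕ} {x : Fin N → ℝ} (hx : x ∈ (PhiO : Set (Fin N → ℝ))) :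
    inn x x = 2 := by
  obtain ⟨i, j, hij, s, t, hs, ht, rfl⟩ := hx
  rw [inn_add_left, inn_smul_left, inn_smul_left, inn_kvec_left, inn_kvec_left]
  simp only [kvec, Pi.add_apply, Pi.smul_apply, smul_eq_mul, hij.ne, hij.ne', if_true, if_false]
  rcases hs with rfl | rfl <;> rcases ht with rfl | rfl <;> norm_num

lemma apply_of_mem_PhiO {N : ℕ} {x : Fin N → ℝ} (hx : x ∈ (PhiO : Set (Fin N → ℝ)))
    (m : Fin N) : x m = 1 ∨ x m = -1 ∨ x m = 0 := by
  obtain ⟨i, j, hij, s, t, hs, ht, rfl⟩ := hx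
  simp only [kvec, Pi.add_apply, Pi.smul_apply, smul_eq_mul]
  rcases hs with rfl | rfl <;> rcases ht with rfl | rfl <;> split_ifs <;>
    first | omega | norm_num

lemma apply_of_mem_PhiS {N : ℕ} {x : Fin N → ℝ} (hx : x ∈ (PhiS : Set (Fin N → ℝ)))
    (m : Fin N) : x m = 1 / 2 ∨ x m = -(1 / 2) := by
  obtain ⟨e, he, -, rfl⟩ := hx
  rcases he m with h | h <;> simp only [h] <;> norm_num

lemma alphaRoot_add_mem_Phi {N : ℕ} (hN : 4 ≤ N) (i j : Fin N) (h : DynkinAdj N i j) :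
    alphaRoot i + alphaRoot j ∈ (Phi : Set (Fin N → ℝ)) := by
  have hj := j.2
  rcases h with ⟨h1, h2⟩ | ⟨h1, h2⟩ | ⟨h1, h2⟩
  · refine Or.inl ⟨i, ⟨j + 1, by omega⟩, Fin.lt_def.2 (by simp only; omega), 1, -1, by simp,
      by simp, ?_⟩
    have : (⟨i + 1, by omega⟩ : Fin N) = j := Fin.ext h1.symm
    rw [alphaRoot_eq_sub i (by omega), alphaRoot_eq_sub j h2, this, one_smul, neg_one_smul]
    abel
  · refine Or.inl ⟨i, j, Fin.lt_def.2 (by omega), 1, 1, by simp, by simp, ?_⟩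
    have e1 : (⟨i + 1, by omega⟩ : Fin N) = ⟨N - 3, by omega⟩ := Fin.ext (by simp only; omega)
    have e2 : (⟨N - 2, by omega⟩ : Fin N) = j := Fin.ext (by simp only; omega)
    rw [alphaRoot_eq_sub i (by omega), alphaRoot_eq_add (by omega) j h2, e1, e2, one_smul,
      one_smul]
    abel
  · refine Or.inr ⟨fun m => if (m : ℕ) = N - 3 ∨ (m : ℕ) = N - 2 then 1 else -1, ?_, ?_, ?_⟩
    · intro m
      by_cases hm : (m : ℕ) = N - 3 ∨ (m : ℕ) = N - 2 <;> simp [hm]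
    · have : (univ.filter fun m : Fin N =>
          (if (m : ℕ) = N - 3 ∨ (m : ℕ) = N - 2 then (1 : ℝ) else -1) = 1) =
          {⟨N - 3, by omega⟩, ⟨N - 2, by omega⟩} := by
        ext m
        simp only [mem_filter, mem_univ, true_and, mem_insert, mem_singleton, Fin.ext_iff]
        split_ifs with hm
        · simp [hm]
        · simp only [hm, iff_false]
          norm_num
      rw [this, card_pair (by simp only [ne_eq, Fin.ext_iff]; omega)]
      exact even_two
    · funext m
      rw [alphaRoot_last j h2]
      simp only [alphaRoot, Pi.add_apply]
      split_ifs <;> first | omega | norm_num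

lemma alphaRoot_add_mem_Phi_iff {N : ℕ} (hN : 4 ≤ N) (i j : Fin N) (hij : i < j) :
    alphaRoot i + alphaRoot j ∈ (Phi : Set (Fin N → ℝ)) ↔ DynkinAdj N i j := by
  refine ⟨fun hmem => ?_, alphaRoot_add_mem_Phi hN i j⟩
  by_contra hadj
  have hij' : (i : ℕ) < j := hij
  have hj := j.2
  by_cases hl : (j : ℕ) + 1 = N
  · have hi : (i : ℕ) + 3 ≤ N := by unfold DynkinAdj at hadj; omega
    have hv : (alphaRoot i + alphaRoot j : Fin N → ℝ) ⟨i + 1, by omega⟩ = -(3 / 2) := by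
      rw [alphaRoot_last j hl, alphaRoot_eq_sub i hi]
      simp only [kvec, Pi.add_apply, Pi.sub_apply, Fin.ext_iff]
      split_ifs <;> first | omega | norm_num
    rcases hmem with h | h
    · rcases apply_of_mem_PhiO h ⟨i + 1, by omega⟩ with h | h | h <;> rw [hv] at h <;>
        norm_num at h
    · rcases apply_of_mem_PhiS h ⟨i + 1, by omega⟩ with h | h <;> rw [hv] at h <;>
        norm_num at h
  · rcases hmem with h | h
    · have h2 := inn_self_of_mem_PhiO h
      rw [inn_add_left, inn_comm, inn_add_left, inn_comm (alphaRoot j) (alphaRoot i + alphaRoot j),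
        inn_add_left, inn_comm (alphaRoot j) (alphaRoot i), inn_alphaRoot_self hN,
        inn_alphaRoot_self hN, inn_alphaRoot_of_lt hN i j hij, if_neg hadj, if_neg hl,
        if_neg (by omega)] at h2
      norm_num at h2
    · have h2 := apply_of_mem_PhiS h ⟨N - 1, by omega⟩
      have hv : (alphaRoot i + alphaRoot j : Fin N → ℝ) ⟨N - 1, by omega⟩ = 0 := by
        simp only [alphaRoot, Pi.add_apply]
        split_ifs <;> first | omega | norm_num
      rw [hv] at h2
      norm_num at h2

/-- The Gram matrix of the simple extended roots, with the norm of the last one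
replaced by `2`. -/
def cartanEntry {N : ℕ} (i j : Fin N) : ℤ :=
  if i = j then 2 else if DynkinAdj N i j ∨ DynkinAdj N j i then -1 else 0

lemma DynkinAdj.lt {N i j : ℕ} (h : DynkinAdj N i j) : i < j := by
  unfold DynkinAdj at h
  omega

lemma cartanEntry_comm {N : ℕ} (i j : Fin N) : cartanEntry i j = cartanEntry j i := by
  simp only [cartanEntry, eq_comm, or_comm]

lemma cartanEntry_of_lt {N : ℕ} {i j : Fin N} (h : i < j) :
    cartanEntry i j = if DynkinAdj N i j then -1 else 0 := by
  have h' : ¬ DynkinAdj N j i := fun hd => absurd hd.lt (by rw [Fin.lt_def] at h; omega)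
  simp only [cartanEntry, h.ne, h', or_false, if_false]

lemma epsSign_mul_epsSign {N : ℕ} (hN : 4 ≤ N) (i j : Fin N) :
    epsSign i j * epsSign j i = (-1 : ℤˣ) ^ cartanEntry i j := by
  wlog hij : i ≤ j generalizing i j
  · rw [mul_comm, cartanEntry_comm, this j i (le_of_not_ge hij)]
  rcases hij.eq_or_lt with rfl | hlt
  · simp [epsSign, cartanEntry]
  · rw [cartanEntry_of_lt hlt]
    simp only [epsSign, hlt.ne, hlt.ne', hlt, hlt.not_gt, and_false, and_true, if_false, one_mul,
      add_comm (alphaRoot j), alphaRoot_add_mem_Phi_iff hN i j hlt]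
    split_ifs <;> simp

lemma inn_alphaRoot (n : ℕ) (i j : Fin (4 * (n + 1))) :
    inn (alphaRoot i : Fin (4 * (n + 1)) → ℝ) (alphaRoot j) =
      ((cartanEntry i j +
        if i = ⟨4 * (n + 1) - 1, by omega⟩ ∧ j = ⟨4 * (n + 1) - 1, by omega⟩
          then (n : ℤ) - 1 else 0 : ℤ) : ℝ) := by
  wlog hij : i ≤ j generalizing i j
  · rw [inn_comm, cartanEntry_comm, this j i (le_of_not_ge hij)]
    simp only [and_comm]
  rcases hij.eq_or_lt with rfl | hlt
  · rw [inn_alphaRoot_self (by omega)]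
    simp only [cartanEntry, Fin.ext_iff, if_true, and_self]
    split_ifs
    · push_cast
      ring
    · omega
    · omega
    · norm_num
  · rw [inn_alphaRoot_of_lt (by omega) i j hlt, cartanEntry_of_lt hlt]
    split_ifs with h1 h2 h2 <;>
      first | exact absurd (h2.1.trans h2.2.symm) hlt.ne | norm_num

lemma zpow_sum_eq_prod {ι G : Type*} [CommGroup G] (s : Finset ι) (g : G) (f : ι → ℤ) :
    g ^ (∑ i ∈ s, f i) = ∏ i ∈ s, g ^ f i := by
  induction s using Finset.cons_induction with
  | empty => simp
  | cons a s ha ih => rw [sum_cons, prod_cons, zpow_add, ih]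

lemma epsFun_mul_epsFun {N : ℕ} (hN : 4 ≤ N) (a b : Fin N → ℤ) :
    epsFun a b * epsFun b a = (-1 : ℤˣ) ^ ∑ i, ∑ j, a i * b j * cartanEntry i j := by
  simp only [zpow_sum_eq_prod, epsFun]
  rw [prod_comm (f := fun i j => epsSign i j ^ (b i * a j)), ← prod_mul_distrib]
  refine prod_congr rfl fun i _ => ?_
  rw [← prod_mul_distrib]
  refine prod_congr rfl fun j _ => ?_
  rw [mul_comm (b j), ← mul_zpow, epsSign_mul_epsSign hN, ← zpow_mul, mul_comm (cartanEntry i j)]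

/-- For α = ∑ m_i α_i and β = ∑ n_i α_i in L, (α,β) is an integer p and
ε(α,β)ε(β,α) = (-1)^{p - m_N n_N (n-1)}. -/
theorem stmt14 (n : ℕ) (hn : 1 ≤ n) (a b : Fin (4*(n+1)) → ℤ) :
    ∃ p : ℤ,
      inn (toVec a) (toVec b) = (p : ℝ) ∧
      epsFun a b * epsFun b a
        = (-1 : ℤˣ) ^ (p - a ⟨4*(n+1)-1, by omega⟩ * b ⟨4*(n+1)-1, by omega⟩ * ((n : ℤ) - 1)) := by
  have hN : 4 ≤ 4 * (n + 1) := by omega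
  refine ⟨∑ i, ∑ j, a i * b j * cartanEntry i j +
    a ⟨4*(n+1)-1, by omega⟩ * b ⟨4*(n+1)-1, by omega⟩ * ((n : ℤ) - 1), ?_, ?_⟩
  · have key : ∑ i, ∑ j, a i * b j * (cartanEntry i j +
        if i = ⟨4*(n+1)-1, by omega⟩ ∧ j = ⟨4*(n+1)-1, by omega⟩ then (n : ℤ) - 1 else 0) =
        ∑ i, ∑ j, a i * b j * cartanEntry i j +
          a ⟨4*(n+1)-1, by omega⟩ * b ⟨4*(n+1)-1, by omega⟩ * ((n : ℤ) - 1) := by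
      simp only [mul_add (a _ * b _), sum_add_distrib, ite_and, mul_ite, mul_zero, sum_ite_irrel,
        sum_ite_eq', mem_univ, if_true, sum_const_zero]
    rw [← key, inn_toVec]
    simp only [inn_alphaRoot, Int.cast_sum, Int.cast_mul]
  · rw [epsFun_mul_epsFun hN, add_sub_cancel_right]
end
end

section
/- The tip T_{(1,1)} = {x ∈ Φ : (x, k_1 − k_2) = 1 and (x, k_1 + k_2 − 2k_3) = 1} of the Magic Star of e8^(n) is exactly the union of: the three roots ρ_1 = k_1 + k_N, ρ_2 = k_1 − k_N, ρ_3 = −k_2 − k_3; the set T_O' = {k_1 ± k_j : 4 ≤ j ≤ N−1}; and the set T_S = {(1/2)(k_1 − k_2 − k_3 ± k_4 ± ⋯ ± k_N) ∈ Φ_S} (i.e. those elements of Φ_S whose first three coefficients are +1/2, −1/2, −1/2). In particular T_{(1,1)} has exactly 3 + 8n + 2^{4n} elements. -/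
noncomputable section

open Finset

attribute [local instance] Classical.propDecidable

theorem inn_sub {N : ℕ} (x y z : Fin N → ℝ) : inn x (y - z) = inn x y - inn x z := by
  simp [inn, mul_sub]

theorem inn_add {N : ℕ} (x y z : Fin N → ℝ) : inn x (y + z) = inn x y + inn x z := by
  simp [inn, mul_add, Finset.sum_add_distrib]

theorem inn_smul {N : ℕ} (c : ℝ) (x y : Fin N → ℝ) : inn x (c • y) = c * inn x y := by
  simp [inn, Finset.mul_sum, mul_left_comm]

theorem inn_kvec {N : ℕ} (x : Fin N → ℝ) (i : Fin N) : inn x (kvec i) = x i := by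
  simp [inn, kvec]

/-- The vector with coordinate `1/2` on `B` and `-1/2` off `B`. -/
def spinor {N : ℕ} (B : Finset (Fin N)) : Fin N → ℝ := fun i => if i ∈ B then 1 / 2 else -(1 / 2)

theorem spinor_eq_half {N : ℕ} (B : Finset (Fin N)) (i : Fin N) :
    spinor B i = 1 / 2 ↔ i ∈ B := by
  unfold spinor; split_ifs <;> simp_all; norm_num

theorem spinor_eq_neg_half {N : ℕ} (B : Finset (Fin N)) (i : Fin N) :
    spinor B i = -(1 / 2) ↔ i ∉ B := by
  unfold spinor; split_ifs <;> simp_all; norm_num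

theorem spinor_injective {N : ℕ} : Function.Injective (spinor (N := N)) := by
  intro B C h
  ext i
  rw [← spinor_eq_half, h, spinor_eq_half]

theorem mem_PhiS_iff {N : ℕ} (x : Fin N → ℝ) :
    x ∈ (PhiS : Set (Fin N → ℝ)) ↔ ∃ B : Finset (Fin N), Even B.card ∧ x = spinor B := by
  constructor
  · rintro ⟨ε, hε, he, rfl⟩
    refine ⟨_, he, funext fun i => ?_⟩
    rcases hε i with h | h <;> simp only [spinor, Finset.mem_filter, Finset.mem_univ, h] <;> norm_num
  · rintro ⟨B, hB, rfl⟩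
    refine ⟨fun i => if i ∈ B then 1 else -1, fun i => ?_, ?_, funext fun i => ?_⟩
    · by_cases h : i ∈ B <;> simp [h]
    · convert hB using 2
      ext i
      by_cases h : i ∈ B <;> simp [h]; norm_num
    · by_cases h : i ∈ B <;> simp [spinor, h]; norm_num

section Tip

variable {N : ℕ} {a b c : Fin N}

theorem PhiO_tip (hab : a < b) (hbc : b < c) (hc : ∀ j, j ≠ a → j ≠ b → j ≠ c → c < j)
    (x : Fin N → ℝ) :
    (x ∈ (PhiO : Set (Fin N → ℝ)) ∧ x a - x b = 1 ∧ x a + x b - 2 * x c = 1) ↔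
      x = -kvec b - kvec c ∨ ∃ j, c < j ∧ (x = kvec a + kvec j ∨ x = kvec a - kvec j) := by
  constructor
  · rintro ⟨⟨i, j, hij, s, t, hs, ht, rfl⟩, h1, h2⟩
    simp only [Pi.add_apply, Pi.smul_apply, kvec, smul_eq_mul] at h1 h2
    by_cases hia : i = a
    · subst hia
      have hj : i ≠ j := hij.ne
      right
      have hjb : b ≠ j := by
        rintro rfl
        rcases hs with rfl | rfl <;> rcases ht with rfl | rfl <;>
          simp [hab.ne, hab.ne', hbc.ne', (hab.trans hbc).ne'] at h1 h2
      have hjc : c ≠ j := by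
        rintro rfl
        rcases hs with rfl | rfl <;> rcases ht with rfl | rfl <;>
          simp [hab.ne', hbc.ne, (hab.trans hbc).ne, (hab.trans hbc).ne'] at h1 h2 <;>
          linarith
      refine ⟨j, hc j hj.symm hjb.symm hjc.symm, ?_⟩
      have hs1 : s = 1 := by simpa [hj, hjb, hab.ne'] using h1
      subst hs1
      rcases ht with rfl | rfl <;> simp [sub_eq_add_neg]
    · have hja : j ≠ a := by
        rintro rfl
        by_cases hib : i = b
        · exact absurd (hij.trans hab) (by simp [hib])
        · by_cases hic : i = c
          · exact absurd (hij.trans (hab.trans hbc)) (by simp [hic])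
          · exact lt_asymm hij ((hab.trans hbc).trans (hc i hia hib hic))
      have hib : i = b := by
        by_contra hib
        have hjb : j ≠ b := by
          rintro rfl
          by_cases hic : i = c
          · exact absurd (hij.trans hbc) (by simp [hic])
          · exact lt_asymm hij (hbc.trans (hc i hia hib hic))
        simp [Ne.symm hia, hja.symm, Ne.symm hib, hjb.symm] at h1
      subst hib
      have ht1 : s = -1 := by
        simp [Ne.symm hia, hja.symm, hij.ne] at h1; linarith
      subst ht1
      have hjc : c = j := by
        by_contra hjc
        simp [Ne.symm hia, hja.symm, hij.ne, hjc, hbc.ne'] at h2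
        norm_num at h2
      subst hjc
      left
      rcases ht with rfl | rfl
      · simp [hab.ne, hja.symm, hij.ne, hij.ne'] at h2; norm_num at h2
      · simp [sub_eq_add_neg]
  · rintro (rfl | ⟨j, hj, rfl | rfl⟩)
    · refine ⟨⟨b, c, hbc, -1, -1, by simp, by simp, by simp [sub_eq_add_neg]⟩, ?_, ?_⟩ <;>
        simp [kvec, hab.ne, hbc.ne, hbc.ne', (hab.trans hbc).ne]; norm_num
    · refine ⟨⟨a, j, hab.trans (hbc.trans hj), 1, 1, by simp, by simp, by simp⟩, ?_, ?_⟩ <;>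
        simp [kvec, hab.ne', hj.ne, (hbc.trans hj).ne, (hab.trans (hbc.trans hj)).ne,
          (hab.trans hbc).ne']
    · refine ⟨⟨a, j, hab.trans (hbc.trans hj), 1, -1, by simp, by simp,
        by simp [sub_eq_add_neg]⟩, ?_, ?_⟩ <;>
        simp [kvec, hab.ne', hj.ne, (hbc.trans hj).ne, (hab.trans (hbc.trans hj)).ne,
          (hab.trans hbc).ne']

theorem PhiS_tip (x : Fin N → ℝ) (hx : x ∈ (PhiS : Set (Fin N → ℝ))) :
    (x a - x b = 1 ∧ x a + x b - 2 * x c = 1) ↔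
      (x a = 1 / 2 ∧ x b = -(1 / 2) ∧ x c = -(1 / 2)) := by
  obtain ⟨B, -, rfl⟩ := (mem_PhiS_iff x).1 hx
  unfold spinor
  split_ifs <;> norm_num

theorem ncard_PhiO_tip (hab : a < b) (hbc : b < c) :
    {x : Fin N → ℝ | x = -kvec b - kvec c ∨
      ∃ j, c < j ∧ (x = kvec a + kvec j ∨ x = kvec a - kvec j)}.ncard
      = 1 + 2 * (Finset.Ioi c).card := by
  have hac := hab.trans hbc
  have hinj : Function.Injective (kvec : Fin N → Fin N → ℝ) := by
    intro i j h
    by_contra hne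
    simpa [kvec, hne] using congrFun h i
  have hset : {x : Fin N → ℝ | x = -kvec b - kvec c ∨
      ∃ j, c < j ∧ (x = kvec a + kvec j ∨ x = kvec a - kvec j)}
      = ↑(({-kvec b - kvec c} : Finset (Fin N → ℝ)) ∪
        ((Finset.Ioi c).image (fun j => kvec a + kvec j) ∪
          (Finset.Ioi c).image (fun j => kvec a - kvec j))) := by
    ext x
    simp only [Set.mem_ofPred_eq, Finset.coe_union, Finset.coe_singleton, Finset.coe_image,
      Finset.coe_Ioi, Set.mem_union, Set.mem_singleton_iff, Set.mem_image, Set.mem_Ioi]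
    grind
  rw [hset, Set.ncard_coe_finset, Finset.card_union_of_disjoint, Finset.card_union_of_disjoint,
    Finset.card_image_of_injective, Finset.card_image_of_injective, Finset.card_singleton, two_mul]
  · exact fun i j h => hinj (sub_right_injective h)
  · exact fun i j h => hinj (add_right_injective _ h)
  · simp only [Finset.disjoint_left, Finset.mem_image, Finset.mem_Ioi]
    rintro _ ⟨j, hj, rfl⟩ ⟨k, hk, h⟩
    have := congrFun h j
    simp only [Pi.sub_apply, Pi.add_apply, kvec, (hac.trans hj).ne', if_true, if_false] at this
    split_ifs at this <;> norm_num at this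
  · simp only [Finset.disjoint_left, Finset.mem_singleton, Finset.mem_union, Finset.mem_image,
      Finset.mem_Ioi]
    rintro _ rfl (⟨j, hj, h⟩ | ⟨j, hj, h⟩)
    all_goals
      have := congrFun h a
      simp [kvec, hab.ne, hac.ne, (hac.trans hj).ne] at this

theorem ncard_PhiS_tip {d : Fin N} (hab : a < b) (hbc : b < c) (hcd : c < d)
    (hc : ∀ j, j ≠ a → j ≠ b → j ≠ c → c < j) (hd : ∀ j, j ≤ d) :
    {x ∈ (PhiS : Set (Fin N → ℝ)) |
      x a = 1 / 2 ∧ x b = -(1 / 2) ∧ x c = -(1 / 2)}.ncard = 2 ^ (Finset.Ioo c d).card := by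
  have hac := hab.trans hbc
  have haI : a ∉ Finset.Ioo c d := by simp [hac.le]
  have hdI : d ∉ Finset.Ioo c d := by simp
  have hda : d ≠ a := (hac.trans hcd).ne'
  let F : Finset (Fin N) → Finset (Fin N) := fun A =>
    if Even A.card then insert a (insert d A) else insert a A
  have hF : ∀ A ⊆ Finset.Ioo c d, ∀ i ∈ Finset.Ioo c d, (i ∈ F A ↔ i ∈ A) := by
    intro A _ i hi
    have h1 : i ≠ a := fun h => haI (h ▸ hi)
    have h2 : i ≠ d := fun h => hdI (h ▸ hi)
    simp only [F]
    split_ifs <;> simp [h1, h2]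
  have hset : {x ∈ (PhiS : Set (Fin N → ℝ)) |
      x a = 1 / 2 ∧ x b = -(1 / 2) ∧ x c = -(1 / 2)}
      = (fun A => spinor (F A)) '' ↑(Finset.Ioo c d).powerset := by
    ext x
    simp only [Set.mem_ofPred_eq, Set.mem_image, Finset.mem_coe, Finset.mem_powerset]
    constructor
    · rintro ⟨hx, ha, hb, hc'⟩
      obtain ⟨B, hB, rfl⟩ := (mem_PhiS_iff x).1 hx
      rw [spinor_eq_half] at ha
      rw [spinor_eq_neg_half] at hb hc'
      refine ⟨B ∩ Finset.Ioo c d, Finset.inter_subset_right, congrArg spinor ?_⟩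
      have haA : a ∉ B ∩ Finset.Ioo c d := fun h => haI (Finset.mem_inter.1 h).2
      have hdA : d ∉ B ∩ Finset.Ioo c d := fun h => hdI (Finset.mem_inter.1 h).2
      have hmem : ∀ i, i ∈ B → i = a ∨ i = d ∨ i ∈ B ∩ Finset.Ioo c d := by
        intro i hi
        by_cases h1 : i = a
        · exact Or.inl h1
        by_cases h2 : i = d
        · exact Or.inr (Or.inl h2)
        refine Or.inr (Or.inr (Finset.mem_inter.2 ⟨hi, Finset.mem_Ioo.2
          ⟨hc i h1 ?_ ?_, lt_of_le_of_ne (hd i) h2⟩⟩))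
        · rintro rfl; exact hb hi
        · rintro rfl; exact hc' hi
      by_cases hdB : d ∈ B
      · have h : B = insert a (insert d (B ∩ Finset.Ioo c d)) := by
          ext i
          have := hmem i
          simp only [Finset.mem_insert]
          refine ⟨this, ?_⟩
          rintro (rfl | rfl | h)
          exacts [ha, hdB, (Finset.mem_inter.1 h).1]
        have hcard := congrArg Finset.card h
        rw [Finset.card_insert_of_notMem (by simp [hda.symm, haI]),
          Finset.card_insert_of_notMem hdA] at hcard
        have he : Even (B ∩ Finset.Ioo c d).card := by
          rw [hcard] at hB
          simpa [Nat.even_add_one] using hB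
        simp only [F, if_pos he]
        exact h.symm
      · have h : B = insert a (B ∩ Finset.Ioo c d) := by
          ext i
          have := hmem i
          simp only [Finset.mem_insert]
          constructor
          · intro hi
            rcases this hi with h | rfl | h
            exacts [Or.inl h, absurd hi hdB, Or.inr h]
          · rintro (rfl | h)
            exacts [ha, (Finset.mem_inter.1 h).1]
        have hcard := congrArg Finset.card h
        rw [Finset.card_insert_of_notMem haA] at hcard
        have he : ¬ Even (B ∩ Finset.Ioo c d).card := by
          rw [hcard] at hB
          simpa [Nat.even_add_one] using hB
        simp only [F, if_neg he]
        exact h.symm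
    · rintro ⟨A, hA, rfl⟩
      rw [mem_PhiS_iff, spinor_eq_half, spinor_eq_neg_half, spinor_eq_neg_half]
      have haA : a ∉ A := fun h => haI (hA h)
      have hdA : d ∉ A := fun h => hdI (hA h)
      have hbA : b ∉ A := fun h => (hbc.trans (Finset.mem_Ioo.1 (hA h)).1).false
      have hcA : c ∉ A := fun h => (Finset.mem_Ioo.1 (hA h)).1.false
      refine ⟨⟨F A, ?_, rfl⟩, ?_, ?_, ?_⟩ <;> simp only [F] <;> split_ifs with he
      · rw [Finset.card_insert_of_notMem (by simp [hda.symm, haA]),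
          Finset.card_insert_of_notMem hdA]
        simpa [Nat.even_add_one] using he
      · rw [Finset.card_insert_of_notMem haA]
        simpa [Nat.even_add_one] using he
      · simp
      · simp
      · simp [hab.ne', (hbc.trans hcd).ne, hbA]
      · simp [hab.ne', hbA]
      · simp [hac.ne', hcd.ne, hcA]
      · simp [hac.ne', hcA]
  rw [hset, Set.InjOn.ncard_image, Set.ncard_coe_finset, Finset.card_powerset]
  intro A hA A' hA' h
  simp only [Finset.mem_coe, Finset.mem_powerset] at hA hA'
  have h' := spinor_injective h
  ext i
  by_cases hi : i ∈ Finset.Ioo c d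
  · rw [← hF A hA i hi, ← hF A' hA' i hi, h']
  · exact ⟨fun h => absurd (hA h) hi, fun h => absurd (hA' h) hi⟩

theorem Phi_tip (hab : a < b) (hbc : b < c) (hc : ∀ j, j ≠ a → j ≠ b → j ≠ c → c < j) :
    {x ∈ (Phi : Set (Fin N → ℝ)) | inn x (kvec a - kvec b) = 1 ∧
        inn x (kvec a + kvec b - (2 : ℝ) • kvec c) = 1}
      = {x | x = -kvec b - kvec c ∨ ∃ j, c < j ∧ (x = kvec a + kvec j ∨ x = kvec a - kvec j)} ∪
        {x ∈ (PhiS : Set (Fin N → ℝ)) | x a = 1 / 2 ∧ x b = -(1 / 2) ∧ x c = -(1 / 2)} := by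
  ext x
  simp only [Phi, inn_sub, inn_add, inn_smul, inn_kvec, Set.mem_ofPred_eq, Set.mem_union,
    or_and_right]
  exact or_congr (PhiO_tip hab hbc hc x) (and_congr_right fun hx => PhiS_tip x hx)

theorem ncard_Phi_tip {d : Fin N} (hab : a < b) (hbc : b < c) (hcd : c < d)
    (hc : ∀ j, j ≠ a → j ≠ b → j ≠ c → c < j) (hd : ∀ j, j ≤ d) :
    {x ∈ (Phi : Set (Fin N → ℝ)) | inn x (kvec a - kvec b) = 1 ∧
        inn x (kvec a + kvec b - (2 : ℝ) • kvec c) = 1}.ncard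
      = 1 + 2 * (Finset.Ioi c).card + 2 ^ (Finset.Ioo c d).card := by
  have hO := ncard_PhiO_tip hab hbc
  have hS := ncard_PhiS_tip hab hbc hcd hc hd
  rw [Phi_tip hab hbc hc, Set.ncard_union_eq ?_ (Set.finite_of_ncard_ne_zero (by omega))
    (Set.finite_of_ncard_ne_zero (by rw [hS]; positivity)), hO, hS]
  rw [Set.disjoint_left]
  rintro x hx ⟨-, ha, hb, -⟩
  have hac := hab.trans hbc
  rcases hx with rfl | ⟨j, hj, rfl | rfl⟩
  · simp [kvec, hab.ne, hac.ne] at ha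
  · simp [kvec, (hac.trans hj).ne] at ha
  · simp [kvec, (hac.trans hj).ne] at ha

end Tip

/-- The tip T_{(1,1)} of the Magic Star of e8^(n) is exactly
{ρ_1, ρ_2, ρ_3} ∪ T_O' ∪ T_S, where ρ_1 = k_1 + k_N, ρ_2 = k_1 - k_N,
ρ_3 = -k_2 - k_3, T_O' = {k_1 ± k_j : 4 ≤ j ≤ N-1}, and T_S consists of the
elements of Φ_S with first three coefficients +1/2, -1/2, -1/2.
In particular it has exactly 3 + 8n + 2^{4n} elements. -/
theorem stmt18 (n : ℕ) (hn : 1 ≤ n) :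
    {x ∈ (Phi : Set (Fin (4*(n+1)) → ℝ)) |
        inn x (kvec ⟨0, by omega⟩ - kvec ⟨1, by omega⟩) = 1 ∧
        inn x (kvec ⟨0, by omega⟩ + kvec ⟨1, by omega⟩ - (2:ℝ) • kvec ⟨2, by omega⟩) = 1}
      = (({kvec ⟨0, by omega⟩ + kvec ⟨4*(n+1)-1, by omega⟩,
           kvec ⟨0, by omega⟩ - kvec ⟨4*(n+1)-1, by omega⟩,
           -(kvec ⟨1, by omega⟩) - kvec ⟨2, by omega⟩} : Set (Fin (4*(n+1)) → ℝ))
        ∪ {x | ∃ j : Fin (4*(n+1)), 3 ≤ (j : ℕ) ∧ (j : ℕ) ≤ 4*(n+1) - 2 ∧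
            (x = kvec ⟨0, by omega⟩ + kvec j ∨ x = kvec ⟨0, by omega⟩ - kvec j)}
        ∪ {x ∈ (PhiS : Set (Fin (4*(n+1)) → ℝ)) |
            x ⟨0, by omega⟩ = 1/2 ∧ x ⟨1, by omega⟩ = -(1/2) ∧ x ⟨2, by omega⟩ = -(1/2)}) ∧
    Set.ncard {x ∈ (Phi : Set (Fin (4*(n+1)) → ℝ)) |
        inn x (kvec ⟨0, by omega⟩ - kvec ⟨1, by omega⟩) = 1 ∧
        inn x (kvec ⟨0, by omega⟩ + kvec ⟨1, by omega⟩ - (2:ℝ) • kvec ⟨2, by omega⟩) = 1}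
      = 3 + 8*n + 2^(4*n) := by
  have hab : (⟨0, by omega⟩ : Fin (4*(n+1))) < ⟨1, by omega⟩ := by simp
  have hbc : (⟨1, by omega⟩ : Fin (4*(n+1))) < ⟨2, by omega⟩ := by
    rw [Fin.mk_lt_mk]; omega
  have hcd : (⟨2, by omega⟩ : Fin (4*(n+1))) < ⟨4*(n+1)-1, by omega⟩ := by
    rw [Fin.mk_lt_mk]; omega
  have hc : ∀ j : Fin (4*(n+1)), j ≠ ⟨0, by omega⟩ → j ≠ ⟨1, by omega⟩ → j ≠ ⟨2, by omega⟩ →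
      (⟨2, by omega⟩ : Fin (4*(n+1))) < j := by
    intro j h0 h1 h2
    simp only [ne_eq, Fin.ext_iff] at h0 h1 h2
    rw [Fin.lt_def]
    dsimp only
    omega
  have hd : ∀ j : Fin (4*(n+1)), j ≤ ⟨4*(n+1)-1, by omega⟩ := by
    intro j
    rw [Fin.le_def]
    dsimp only
    omega
  refine ⟨?_, ?_⟩
  · rw [Phi_tip hab hbc hc]
    congr 1
    ext x
    simp only [Set.mem_ofPred_eq, Set.mem_union, Set.mem_insert_iff, Set.mem_singleton_iff]
    constructor
    · rintro (h | ⟨j, hj, h⟩)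
      · exact Or.inl (Or.inr (Or.inr h))
      · by_cases hjd : j = ⟨4*(n+1)-1, by omega⟩
        · rw [hjd] at h
          tauto
        · rw [Fin.ext_iff] at hjd
          rw [Fin.lt_def] at hj
          dsimp only at hj hjd
          exact Or.inr ⟨j, by omega, by omega, h⟩
    · rintro ((h | h | h) | ⟨j, hj, -, h⟩)
      · exact Or.inr ⟨_, hcd, Or.inl h⟩
      · exact Or.inr ⟨_, hcd, Or.inr h⟩
      · exact Or.inl h
      · exact Or.inr ⟨j, by rw [Fin.lt_def]; dsimp only; omega, h⟩
  · rw [ncard_Phi_tip hab hbc hcd hc hd, Fin.card_Ioi, Fin.card_Ioo]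
    dsimp only
    rw [show 4*(n+1) - 1 - 2 - 1 = 4*n by omega]
    omega
end
end
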